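/- arXiv:1108.5603 — 2 statements merged into one kernel-verified Lean document; each statement's English description precedes it below -/
import Mathlib

section
/- Let n = 2t be even with n ≥ 4, let s be an integer with 2 ≤ s ≤ 2^(n−1), and let N be an integer with 2^(n−1) + C(n,t)/2 − t < N ≤ 2^n. Let r be the unique integer with ∑_{k=r+1}^n C(n,k) ≤ N < ∑_{k=r}^n C(n,k). Then every family 𝓐 of subsets of [n] with |𝓐| = N that maximises |𝕀^(s)(𝓐)| over all families of subsets of [n] of size N is of the form 𝓐 = [n]^(≥r+1) ∪ 𝓑 with 𝓑 ⊆ [n]^(r); equivalently, [n]^(≥r+1) ⊆ 𝓐 and every set of 𝓐 has size at least r. -/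
open Finset

/-- The ground set `[n] = {1, …, n}`. -/
def groundSet (n : ℕ) : Finset ℕ := Finset.Icc 1 n

/-- All subsets of `[n]`. -/
def allFams (n : ℕ) : Finset (Finset ℕ) := (groundSet n).powerset

/-- `[n]^(≥ r)`: subsets of `[n]` of size at least `r`. -/
def layerGE (n r : ℕ) : Finset (Finset ℕ) := (allFams n).filter fun A => r ≤ A.card

/-- `[n]^(r)`: subsets of `[n]` of size exactly `r`. -/
def layerEQ (n r : ℕ) : Finset (Finset ℕ) := (groundSet n).powersetCard r

/-- `𝕀^(s)(𝓐)`: the intersecting subfamilies of `𝓐` of size `s`. -/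
def interFams (s : ℕ) (𝓐 : Finset (Finset ℕ)) : Finset (Finset (Finset ℕ)) :=
  (𝓐.powersetCard s).filter fun 𝓔 => ∀ B ∈ 𝓔, ∀ B' ∈ 𝓔, (B ∩ B').Nonempty

/-- `τ` pairs each set avoiding `v` with a set containing `v` of size one larger, namely the image
under an involution of the ground set `G` fixing `v`, with `v` added. Only the consequences of
this description that the compression argument needs are recorded. -/
structure IsLift (G : Finset ℕ) (v : ℕ) (τ : Finset ℕ → Finset ℕ) : Prop where
  invol : ∀ X, τ (τ X) = X
  mem_iff : ∀ X, v ∈ τ X ↔ v ∉ X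
  disj : ∀ X Y, v ∉ X → v ∉ Y → Disjoint (τ X) Y → Disjoint X (τ Y)
  sub : ∀ X ⊆ G, τ X ⊆ G
  card_eq : ∀ X, v ∉ X → (τ X).card = X.card + 1
  compl : ∀ X ⊆ G, τ (G \ X) = G \ τ X

lemma exists_involutive_image_eq {E D : Finset ℕ} (h : E.card = D.card) :
    ∃ π : ℕ → ℕ, Function.Involutive π ∧ E.image π = D ∧ ∀ x ∉ E ∪ D, π x = x := by
  classical
  have hc : (E \ D).card = (D \ E).card := by
    have h1 := card_sdiff_add_card_inter E D
    have h2 := card_sdiff_add_card_inter D E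
    rw [inter_comm] at h2
    omega
  let e := Finset.equivOfCardEq hc
  let π : ℕ → ℕ := fun x => if h : x ∈ E \ D then e ⟨x, h⟩ else
    if h : x ∈ D \ E then e.symm ⟨x, h⟩ else x
  have hdisj : ∀ x, x ∈ E \ D → x ∈ D \ E → False := by
    intro x; simp only [mem_sdiff]; tauto
  have p1 : ∀ x (h : x ∈ E \ D), π x = e ⟨x, h⟩ := fun x h => by simp only [π, dif_pos h]
  have p2 : ∀ x (h : x ∈ D \ E), π x = e.symm ⟨x, h⟩ := fun x h => by
    simp only [π, dif_pos h, dif_neg (fun h' => hdisj x h' h)]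
  have p3 : ∀ x, x ∉ E \ D → x ∉ D \ E → π x = x := fun x h h' => by
    simp only [π, dif_neg h, dif_neg h']
  have m1 : ∀ x, x ∈ E \ D → π x ∈ D \ E := fun x h => by
    rw [p1 x h]; exact (e ⟨x, h⟩).2
  have m2 : ∀ x, x ∈ D \ E → π x ∈ E \ D := fun x h => by
    rw [p2 x h]; exact (e.symm ⟨x, h⟩).2
  have hinv : Function.Involutive π := by
    intro x
    by_cases h1 : x ∈ E \ D
    · rw [p2 _ (m1 x h1)]
      simp [p1 x h1]
    · by_cases h2 : x ∈ D \ E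
      · rw [p1 _ (m2 x h2)]
        simp [p2 x h2]
      · rw [p3 x h1 h2, p3 x h1 h2]
  have key : ∀ x ∈ E, π x ∈ D := by
    intro x hx
    by_cases h1 : x ∈ E \ D
    · exact (mem_sdiff.1 (m1 x h1)).1
    · have hD : x ∈ D := by simp only [mem_sdiff] at h1; tauto
      rw [p3 x h1 (by simp [hx])]
      exact hD
  refine ⟨π, hinv, ?_, ?_⟩
  · apply Finset.eq_of_subset_of_card_le
    · intro y hy
      obtain ⟨x, hx, rfl⟩ := mem_image.1 hy
      exact key x hx
    · rw [card_image_of_injective _ hinv.injective, h]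
  · intro x hx
    simp only [mem_union, not_or] at hx
    exact p3 x (by simp [hx.1]) (by simp [hx.2])

lemma exists_isLift {G E D : Finset ℕ} {v : ℕ} (hE : E ⊆ G) (hD : D ⊆ G) (hvD : v ∈ D)
    (hvE : v ∉ E) (h : D.card = E.card + 1) : ∃ τ, IsLift G v τ ∧ τ E = D := by
  classical
  obtain ⟨π, hinv, him, hfix⟩ := exists_involutive_image_eq (E := E) (D := D.erase v)
    (by rw [card_erase_of_mem hvD]; omega)
  have hπv : π v = v := hfix v (by simp [hvE])
  have hπG : ∀ x ∈ G, π x ∈ G := by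
    have hED : ∀ x ∈ E, π x ∈ D := fun x hx =>
      mem_of_mem_erase (him ▸ mem_image_of_mem π hx)
    intro x hx
    by_cases h1 : x ∈ E
    · exact hD (hED x h1)
    · by_cases h2 : x ∈ D.erase v
      · rw [← him] at h2
        obtain ⟨y, hy, rfl⟩ := mem_image.1 h2
        rw [hinv y]
        exact hE hy
      · rw [hfix x (by rw [mem_union]; tauto)]
        exact hx
  have himg : ∀ X x, x ∈ image π X ↔ π x ∈ X := by
    intro X x
    constructor
    · intro hx
      obtain ⟨y, hy, rfl⟩ := mem_image.1 hx
      rwa [hinv y]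
    · intro hx
      exact mem_image.2 ⟨π x, hx, hinv x⟩
  let τ : Finset ℕ → Finset ℕ := fun X =>
    if v ∈ X then (image π X).erase v else insert v (image π X)
  have hm : ∀ X x, x ∈ τ X ↔ (x ≠ v ∧ π x ∈ X) ∨ (x = v ∧ v ∉ X) := by
    intro X x
    by_cases hv : v ∈ X
    · simp only [τ, if_pos hv, mem_erase, himg]; tauto
    · simp only [τ, if_neg hv, mem_insert, himg]
      by_cases hx : x = v
      · simp [hx, hv]
      · simp [hx]
  have hne : ∀ x, x ≠ v → π x ≠ v := fun x hx h' => hx (by rw [← hinv x, h', hπv])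
  refine ⟨τ, ⟨?_, ?_, ?_, ?_, ?_, ?_⟩, ?_⟩
  · intro X
    ext x
    rw [hm, hm, hm]
    by_cases hx : x = v
    · subst hx; simp
    · simp [hx, hne x hx, hinv x]
  · intro X
    rw [hm]; simp
  · intro X Y hX hY hd
    rw [Finset.disjoint_left] at hd ⊢
    intro x hx hxY
    rw [hm] at hxY
    have hxv : x ≠ v := fun h' => hX (h' ▸ hx)
    have hy : π x ∈ Y := by tauto
    refine hd ((hm X (π x)).2 (Or.inl ⟨hne x hxv, ?_⟩)) hy
    rwa [hinv x]
  · intro X hX x hx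
    rw [hm] at hx
    rcases hx with hx | hx
    · rw [← hinv x]
      exact hπG _ (hX hx.2)
    · rw [hx.1]; exact hD hvD
  · intro X hX
    simp only [τ, if_neg hX]
    rw [card_insert_of_notMem (by rw [himg, hπv]; exact hX),
      card_image_of_injective _ hinv.injective]
  · intro X hX
    ext x
    have : π x ∈ G ↔ x ∈ G := ⟨fun h' => hinv x ▸ hπG _ h', hπG x⟩
    simp only [hm, mem_sdiff, this]
    by_cases hx : x = v
    · subst hx; simp [hD hvD]
    · simp [hx]
  · simp only [τ, if_neg hvE, him]
    exact insert_erase hvD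

/-- The compression of `A` along a lift `τ` at `v`: every set of `A` avoiding `v` is replaced by
its lift, unless the lift is already in `A`. -/
def compress (A : Finset (Finset ℕ)) (v : ℕ) (τ : Finset ℕ → Finset ℕ) : Finset (Finset ℕ) :=
  A.image fun X => if v ∉ X ∧ τ X ∉ A then τ X else X

/-- The sets of the subfamily `I` of `A` that have to be lifted when `A` is compressed: those whose
lift is not in `A`, and then, repeatedly, those avoiding `v` disjoint from a lifted set. -/
inductive MovesUp (A : Finset (Finset ℕ)) (v : ℕ) (τ : Finset ℕ → Finset ℕ)
    (I : Finset (Finset ℕ)) : Finset ℕ → Prop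
  | base {X : Finset ℕ} : X ∈ I → v ∉ X → τ X ∉ A → MovesUp A v τ I X
  | step {X Y : Finset ℕ} : MovesUp A v τ I X → Y ∈ I → v ∉ Y → Disjoint (τ X) Y →
      MovesUp A v τ I Y

open Classical in
/-- The subfamily of `compress A v τ` assigned to a subfamily `I` of `A`. -/
noncomputable def liftSub (A : Finset (Finset ℕ)) (v : ℕ) (τ : Finset ℕ → Finset ℕ)
    (I : Finset (Finset ℕ)) : Finset (Finset ℕ) :=
  I.image fun X => if MovesUp A v τ I X then τ X else X

section Compression

variable {G : Finset ℕ} {v : ℕ} {τ : Finset ℕ → Finset ℕ} {A I J : Finset (Finset ℕ)} {s : ℕ}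

lemma mem_interFams : I ∈ interFams s A ↔
    I ⊆ A ∧ I.card = s ∧ ∀ B ∈ I, ∀ B' ∈ I, ¬ Disjoint B B' := by
  simp only [interFams, mem_filter, mem_powersetCard, and_assoc,
    Finset.not_disjoint_iff_nonempty_inter]

lemma IsLift.injective (hτ : IsLift G v τ) : Function.Injective τ := fun X Y h => by
  rw [← hτ.invol X, h, hτ.invol]

lemma MovesUp.mem {X : Finset ℕ} (h : MovesUp A v τ I X) : X ∈ I ∧ v ∉ X := by
  cases h <;> exact ⟨‹_›, ‹_›⟩

lemma mem_compress (hτ : IsLift G v τ) {Y : Finset ℕ} : Y ∈ compress A v τ ↔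
    (v ∈ Y ∧ (Y ∈ A ∨ τ Y ∈ A)) ∨ (v ∉ Y ∧ Y ∈ A ∧ τ Y ∈ A) := by
  simp only [compress, mem_image]
  constructor
  · rintro ⟨X, hX, rfl⟩
    split_ifs with h
    · exact Or.inl ⟨(hτ.mem_iff X).2 h.1, Or.inr (by rwa [hτ.invol])⟩
    · tauto
  · rintro (⟨hv, h | h⟩ | ⟨hv, h, h'⟩)
    · exact ⟨Y, h, if_neg (by tauto)⟩
    · by_cases hY : Y ∈ A
      · exact ⟨Y, hY, if_neg (by tauto)⟩
      · refine ⟨τ Y, h, ?_⟩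
        rw [hτ.invol, if_pos ⟨fun h' => (hτ.mem_iff Y).1 h' hv, hY⟩]
    · exact ⟨Y, h, if_neg (by tauto)⟩

lemma compress_injOn (hτ : IsLift G v τ) :
    Set.InjOn (fun X => if v ∉ X ∧ τ X ∉ A then τ X else X) (A : Set (Finset ℕ)) := by
  intro X hX Y hY h
  simp only [mem_coe] at hX hY
  dsimp only at h
  split_ifs at h with h1 h2 h2
  · exact hτ.injective h
  · exact absurd (h ▸ hY) h1.2
  · exact absurd (h ▸ hX) h2.2
  · exact h

lemma card_compress (hτ : IsLift G v τ) : (compress A v τ).card = A.card :=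
  card_image_of_injOn (compress_injOn hτ)

lemma compress_sub (hτ : IsLift G v τ) (hA : ∀ X ∈ A, X ⊆ G) : ∀ X ∈ compress A v τ, X ⊆ G := by
  intro X hX
  simp only [compress, mem_image] at hX
  obtain ⟨Y, hY, rfl⟩ := hX
  split_ifs
  · exact hτ.sub _ (hA Y hY)
  · exact hA Y hY

lemma sum_card_lt_sum_card_compress (hτ : IsLift G v τ) {E : Finset ℕ} (hE : E ∈ A) (hv : v ∉ E)
    (hE' : τ E ∉ A) : ∑ X ∈ A, X.card < ∑ X ∈ compress A v τ, X.card := by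
  rw [compress, sum_image (compress_injOn hτ)]
  refine sum_lt_sum (fun X _ => ?_) ⟨E, hE, ?_⟩
  · split_ifs with h
    · rw [hτ.card_eq X h.1]; omega
    · rfl
  · rw [if_pos ⟨hv, hE'⟩, hτ.card_eq E hv]; omega

lemma mem_liftSub {Y : Finset ℕ} : Y ∈ liftSub A v τ I ↔
    (Y ∈ I ∧ ¬ MovesUp A v τ I Y) ∨ ∃ X, MovesUp A v τ I X ∧ τ X = Y := by
  simp only [liftSub, mem_image]
  constructor
  · rintro ⟨X, hX, rfl⟩
    split_ifs with h
    · exact Or.inr ⟨X, h, rfl⟩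
    · exact Or.inl ⟨hX, h⟩
  · rintro (⟨h, h'⟩ | ⟨X, hX, rfl⟩)
    · exact ⟨Y, h, if_neg h'⟩
    · exact ⟨X, hX.mem.1, if_pos hX⟩

lemma MovesUp.lift_notMem (hτ : IsLift G v τ) (hI : I ∈ interFams s A) {X : Finset ℕ}
    (h : MovesUp A v τ I X) : τ X ∉ I := by
  obtain ⟨hIA, -, hmeet⟩ := mem_interFams.1 hI
  cases h with
  | base _ _ h => exact fun h' => h (hIA h')
  | step hY hX hv hd => exact fun h' => hmeet _ hY.mem.1 _ h' (hτ.disj _ _ hY.mem.2 hv hd)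

lemma liftSub_mem (hτ : IsLift G v τ) (hI : I ∈ interFams s A) :
    liftSub A v τ I ∈ interFams s (compress A v τ) := by
  obtain ⟨hIA, hcard, hmeet⟩ := mem_interFams.1 hI
  have cross : ∀ X Z, MovesUp A v τ I X → Z ∈ I → ¬ MovesUp A v τ I Z → ¬ Disjoint (τ X) Z := by
    intro X Z hX hZ hZ' hd
    have hvZ : v ∉ Z := fun h => Finset.disjoint_left.1 hd ((hτ.mem_iff X).2 hX.mem.2) h
    exact hZ' (hX.step hZ hvZ hd)
  refine mem_interFams.2 ⟨?_, ?_, ?_⟩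
  · intro Y hY
    rw [mem_compress hτ]
    rcases mem_liftSub.1 hY with ⟨h, h'⟩ | ⟨X, hX, rfl⟩
    · by_cases hv : v ∈ Y
      · exact Or.inl ⟨hv, Or.inl (hIA h)⟩
      · exact Or.inr ⟨hv, hIA h, by_contra fun hc => h' (.base h hv hc)⟩
    · exact Or.inl ⟨(hτ.mem_iff X).2 hX.mem.2, Or.inr (by rw [hτ.invol]; exact hIA hX.mem.1)⟩
  · rw [← hcard]
    apply card_image_of_injOn
    intro X hX Y hY h
    simp only [mem_coe] at hX hY
    dsimp only at h
    split_ifs at h with h1 h2 h2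
    · exact hτ.injective h
    · exact absurd (h ▸ hY) (h1.lift_notMem hτ hI)
    · exact absurd (h ▸ hX) (h2.lift_notMem hτ hI)
    · exact h
  · intro B hB B' hB'
    rcases mem_liftSub.1 hB with ⟨h, h'⟩ | ⟨X, hX, rfl⟩ <;>
    rcases mem_liftSub.1 hB' with ⟨k, k'⟩ | ⟨Y, hY, rfl⟩
    · exact hmeet _ h _ k
    · exact fun hd => cross Y B hY h h' hd.symm
    · exact cross X B' hX k k'
    · exact fun hd => Finset.disjoint_left.1 hd ((hτ.mem_iff X).2 hX.mem.2)
        ((hτ.mem_iff Y).2 hY.mem.2)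

lemma MovesUp.of_liftSub_eq (hτ : IsLift G v τ) (hJ : J ∈ interFams s A)
    (h : liftSub A v τ I = liftSub A v τ J) {X : Finset ℕ} (hX : MovesUp A v τ I X) :
    MovesUp A v τ J X := by
  obtain ⟨hJA, -, hmeet⟩ := mem_interFams.1 hJ
  induction hX with
  | @base X hX hv hA =>
    have : τ X ∈ liftSub A v τ J := h ▸ mem_liftSub.2 (Or.inr ⟨X, .base hX hv hA, rfl⟩)
    rcases mem_liftSub.1 this with ⟨h1, -⟩ | ⟨Z, hZ, hZX⟩
    · exact absurd (hJA h1) hA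
    · rwa [← hτ.injective hZX]
  | @step X Y hX hY hv hd ih =>
    have : τ Y ∈ liftSub A v τ J := h ▸ mem_liftSub.2 (Or.inr ⟨Y, .step hX hY hv hd, rfl⟩)
    rcases mem_liftSub.1 this with ⟨h1, -⟩ | ⟨Z, hZ, hZX⟩
    · exact absurd (hτ.disj _ _ hX.mem.2 hv hd) (hmeet _ ih.mem.1 _ h1)
    · rwa [← hτ.injective hZX]

lemma subset_of_liftSub_eq (hτ : IsLift G v τ) (hI : I ∈ interFams s A) (hJ : J ∈ interFams s A)
    (h : liftSub A v τ I = liftSub A v τ J) : I ⊆ J := by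
  intro X hX
  by_cases hM : MovesUp A v τ I X
  · exact (hM.of_liftSub_eq hτ hJ h).mem.1
  · have : X ∈ liftSub A v τ J := h ▸ mem_liftSub.2 (Or.inl ⟨hX, hM⟩)
    rcases mem_liftSub.1 this with ⟨h1, -⟩ | ⟨Z, hZ, rfl⟩
    · exact h1
    · exact absurd hX ((hZ.of_liftSub_eq hτ hI h.symm).lift_notMem hτ hI)

lemma liftSub_injOn (hτ : IsLift G v τ) :
    Set.InjOn (liftSub A v τ) (interFams s A : Set (Finset (Finset ℕ))) := fun _ hI _ hJ h =>
  (subset_of_liftSub_eq hτ hI hJ h).antisymm (subset_of_liftSub_eq hτ hJ hI h.symm)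

lemma card_interFams_le_compress (hτ : IsLift G v τ) :
    (interFams s A).card ≤ (interFams s (compress A v τ)).card :=
  card_le_card_of_injOn _ (fun _ hI => liftSub_mem hτ hI) (liftSub_injOn hτ)

/-- If compressing does not increase the number of intersecting subfamilies, then a lifted set `τ E`
and a set `W` disjoint from `E` lie together in an intersecting subfamily of the compression
only if `W` is itself a lift. -/
lemma lift_mem_of_card_compress_le (hτ : IsLift G v τ)
    (hle : (interFams s (compress A v τ)).card ≤ (interFams s A).card)
    {E W : Finset ℕ} (hE' : τ E ∉ A)
    (hJ : J ∈ interFams s (compress A v τ)) (hEJ : τ E ∈ J) (hWJ : W ∈ J) (hd : Disjoint W E) :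
    v ∈ W ∧ τ W ∈ A ∧ ¬ Disjoint (τ W) E := by
  obtain ⟨I, hI, rfl⟩ := surj_on_of_inj_on_of_card_le (fun I _ => liftSub A v τ I)
    (fun I hI => liftSub_mem hτ hI) (fun I I' hI hI' h => liftSub_injOn hτ hI hI' h) hle J hJ
  obtain ⟨hIA, -, hmeet⟩ := mem_interFams.1 hI
  have hEM : MovesUp A v τ I E := by
    rcases mem_liftSub.1 hEJ with ⟨h1, -⟩ | ⟨Z, hZ, hZX⟩
    · exact absurd (hIA h1) hE'
    · rwa [← hτ.injective hZX]
  rcases mem_liftSub.1 hWJ with ⟨h1, -⟩ | ⟨Z, hZ, rfl⟩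
  · exact absurd hd (hmeet _ h1 _ hEM.mem.1)
  · rw [hτ.invol]
    exact ⟨(hτ.mem_iff Z).2 hZ.mem.2, hIA hZ.mem.1, hmeet _ hZ.mem.1 _ hEM.mem.1⟩

end Compression

/-- `A` consists of all subsets of `G` of size more than `r`, and some of size `r`. -/
structure IsLayered (G : Finset ℕ) (r : ℕ) (A : Finset (Finset ℕ)) : Prop where
  sub : ∀ X ∈ A, X ⊆ G
  low : ∀ X ∈ A, r ≤ X.card
  up : ∀ X ⊆ G, r < X.card → X ∈ A

lemma disjoint_sdiff_of_card {G X Y : Finset ℕ} {t : ℕ} (hG : G.card = 2 * t) (hX : X ⊆ G)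
    (hY : Y ⊆ G) (hd : Disjoint X Y) (htX : t ≤ X.card) (htY : t ≤ Y.card) :
    X.card = t ∧ Y.card = t ∧ G \ X = Y := by
  have hs : Y ⊆ G \ X := subset_sdiff.2 ⟨hY, hd.symm⟩
  have hc := card_sdiff_of_subset hX
  have hc' := card_le_card hs
  have hXG := card_le_card hX
  refine ⟨by omega, by omega, (eq_of_subset_of_card_le hs (by omega)).symm⟩

lemma exists_mem_interFams_pair {G : Finset ℕ} {t r s : ℕ} {A : Finset (Finset ℕ)}
    (hG : G.card = 2 * t) (hr : r ≤ t) (hA : IsLayered G r A) (hs : 2 ≤ s)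
    (hne : (interFams s A).Nonempty) {D W : Finset ℕ} (hD : D ∈ A) (hW : W ∈ A)
    (hDW : ¬ Disjoint D W) (hWt : t ≤ W.card) : ∃ J ∈ interFams s A, D ∈ J ∧ W ∈ J := by
  classical
  obtain ⟨g, hgD, hgW⟩ := Finset.not_disjoint_iff.1 hDW
  have hgG : g ∈ G := hA.sub D hD hgD
  set F := A.filter fun X => D ⊆ X ∨ (¬ Disjoint X D ∧ (t < X.card ∨
    (X.card = t ∧ (G \ X ∉ A ∨ X = W ∨ (G \ X ≠ W ∧ g ∈ X))))) with hF
  have hDF : D ∈ F := mem_filter.2 ⟨hD, Or.inl Subset.rfl⟩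
  have hWF : W ∈ F := by
    refine mem_filter.2 ⟨hW, Or.inr ⟨fun h => hDW h.symm, ?_⟩⟩
    rcases hWt.lt_or_eq with h | h
    · exact Or.inl h
    · exact Or.inr ⟨h.symm, Or.inr (Or.inl rfl)⟩
  have hFint : ∀ B ∈ F, ∀ B' ∈ F, ¬ Disjoint B B' := by
    intro X hX Y hY hd
    rw [hF, mem_filter] at hX hY
    obtain ⟨hXA, hX⟩ := hX
    obtain ⟨hYA, hY⟩ := hY
    rcases hX with hX | ⟨hX, hXt⟩
    · rcases hY with hY | ⟨hY, -⟩
      · exact Finset.disjoint_left.1 hd (hX hgD) (hY hgD)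
      · exact hY (hd.symm.mono_right hX)
    · rcases hY with hY | ⟨hY, hYt⟩
      · exact hX (hd.mono_right hY)
      · obtain ⟨h1, h2, h3⟩ := disjoint_sdiff_of_card hG (hA.sub X hXA) (hA.sub Y hYA) hd
          (by omega) (by omega)
        obtain ⟨-, -, h4⟩ := disjoint_sdiff_of_card hG (hA.sub Y hYA) (hA.sub X hXA) hd.symm
          (by omega) (by omega)
        have hXY : X ≠ Y := by
          rintro rfl
          rw [disjoint_self_iff_empty] at hd
          exact hX (hd ▸ disjoint_empty_left D)
        have hg : ¬ (g ∈ X ∧ g ∈ Y) := fun h => Finset.disjoint_left.1 hd h.1 h.2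
        rw [h3] at hXt
        rw [h4] at hYt
        rcases hXt with hXt | ⟨-, hXt⟩
        · omega
        rcases hYt with hYt | ⟨-, hYt⟩
        · omega
        rcases hXt with h | rfl | ⟨h, h'⟩
        · exact h hYA
        · rcases hYt with h | h | ⟨h, h'⟩
          · exact h hXA
          · exact hXY h.symm
          · exact h rfl
        · rcases hYt with h5 | h5 | ⟨h5, h5'⟩
          · exact h5 hXA
          · exact h h5
          · exact hg ⟨h', h5'⟩
  have hFc : ∀ X ∈ A, X ∉ F → G \ X ∈ F := by
    intro X hX hXF
    have hXG := hA.sub X hX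
    have hcX : (G \ X).card = 2 * t - X.card := by rw [card_sdiff_of_subset hXG, hG]
    have hle : X.card ≤ 2 * t := hG ▸ card_le_card hXG
    have h0 : ¬ _ := fun h => hXF (mem_filter.2 ⟨hX, h⟩)
    rw [not_or, not_and, not_or, not_and] at h0
    obtain ⟨hDX, h0⟩ := h0
    by_cases hd : Disjoint X D
    · have hs : D ⊆ G \ X := subset_sdiff.2 ⟨hA.sub D hD, hd.symm⟩
      refine mem_filter.2 ⟨?_, Or.inl hs⟩
      have h1 := hA.low D hD
      have h2 := card_le_card hs
      by_cases h3 : r < (G \ X).card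
      · exact hA.up _ sdiff_subset h3
      · rwa [← eq_of_subset_of_card_le hs (by omega)]
    · obtain ⟨h1, h2⟩ := h0 hd
      have hd' : ¬ Disjoint (G \ X) D := by
        obtain ⟨x, hx, hx'⟩ := Finset.not_subset.1 hDX
        exact Finset.not_disjoint_iff.2 ⟨x, mem_sdiff.2 ⟨hA.sub D hD hx, hx'⟩, hx⟩
      rcases (not_lt.1 h1).lt_or_eq with h3 | h3
      · exact mem_filter.2 ⟨hA.up _ sdiff_subset (by omega), Or.inr ⟨hd', Or.inl (by omega)⟩⟩
      · have h4 := h2 h3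
        rw [not_or, not_or, not_not, not_and] at h4
        obtain ⟨h4, h5, h6⟩ := h4
        refine mem_filter.2 ⟨h4, Or.inr ⟨hd', Or.inr ⟨by omega, Or.inr ?_⟩⟩⟩
        by_cases h7 : G \ X = W
        · exact Or.inl h7
        · refine Or.inr ⟨?_, mem_sdiff.2 ⟨hgG, h6 h7⟩⟩
          rwa [Finset.sdiff_sdiff_eq_self hXG]
  obtain ⟨I, hI⟩ := hne
  obtain ⟨hIA, hIs, hIint⟩ := mem_interFams.1 hI
  have hsF : s ≤ F.card := by
    rw [← hIs]
    refine card_le_card_of_injOn (fun X => if X ∈ F then X else G \ X) ?_ ?_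
    · intro X hX
      dsimp only
      split_ifs with h
      · exact h
      · exact hFc X (hIA hX) h
    · intro X hX Y hY h
      dsimp only at h
      split_ifs at h with h1 h2 h2
      · exact h
      · exact absurd (h ▸ sdiff_disjoint) (hIint X hX Y hY)
      · exact absurd (h ▸ disjoint_sdiff) (hIint X hX Y hY)
      · rw [← Finset.sdiff_sdiff_eq_self (hA.sub X (hIA hX)), h,
          Finset.sdiff_sdiff_eq_self (hA.sub Y (hIA hY))]
  obtain ⟨J, hJ1, hJ2, hJ3⟩ := exists_subsuperset_card_eq (s := {D, W}) (t := F) (n := s)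
    (by simp [insert_subset_iff, hDF, hWF]) (card_le_two.trans hs) hsF
  refine ⟨J, mem_interFams.2 ⟨hJ2.trans (filter_subset _ _), hJ3, fun B hB B' hB' =>
    hFint B (hJ2 hB) B' (hJ2 hB')⟩, hJ1 (by simp), hJ1 (by simp)⟩

lemma exists_notMem_and_notMem {S : Finset ℕ} {M : Finset (Finset ℕ)} {P Q : ℕ → Finset ℕ} {f : ℕ}
    (hP : Set.InjOn P S) (hQ : Set.InjOn Q S) (hfP : ∀ x ∈ S, f ∈ P x) (hfQ : ∀ x ∈ S, f ∉ Q x)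
    (hM : M.card < S.card) : ∃ x ∈ S, P x ∉ M ∧ Q x ∉ M := by
  classical
  by_contra! hc
  refine hM.not_ge (card_le_card_of_injOn (fun x => if P x ∈ M then P x else Q x) ?_ ?_)
  · intro x hx
    dsimp only
    split_ifs with h
    · exact h
    · exact hc x hx h
  · intro x hx y hy h
    dsimp only at h
    split_ifs at h with h1 h2 h2
    · exact hP hx hy h
    · exact absurd (h ▸ hfP x hx) (hfQ y hy)
    · exact absurd (h ▸ hfP y hy) (hfQ x hx)
    · exact hQ hx hy h

lemma exists_mem_compl_mem {G E : Finset ℕ} {t : ℕ} {A : Finset (Finset ℕ)} (ht : 2 ≤ t)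
    (hG : G.card = 2 * t) (hM : ((G.powersetCard t).filter (· ∉ A)).card < t) (hE : E ⊆ G)
    (hEt : E.card = t) : ∃ Y ⊆ G, Y.card = t ∧ Y ∈ A ∧ G \ Y ∈ A := by
  have hcE : (G \ E).card = t := by rw [card_sdiff_of_subset hE, hG]; omega
  obtain ⟨f, hf⟩ : (G \ E).Nonempty := card_pos.1 (by omega)
  rw [mem_sdiff] at hf
  have hsub : ∀ x ∈ E, insert f (E.erase x) ⊆ G := fun x _ =>
    insert_subset hf.1 ((erase_subset x E).trans hE)
  have hinj : Set.InjOn (fun x => insert f (E.erase x)) (E : Set ℕ) := by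
    intro x hx y hy h
    by_contra hxy
    have : x ∈ insert f (E.erase y) := mem_insert_of_mem (mem_erase.2 ⟨hxy, hx⟩)
    dsimp only at h
    rw [← h, mem_insert, mem_erase] at this
    rcases this with rfl | ⟨h', -⟩
    · exact hf.2 hx
    · exact h' rfl
  obtain ⟨x, hx, h1, h2⟩ := exists_notMem_and_notMem (S := E) (f := f)
    (P := fun x => insert f (E.erase x)) (Q := fun x => G \ insert f (E.erase x)) hinj
    (fun x hx y hy h => hinj hx hy (by
      dsimp only at h ⊢
      rw [← Finset.sdiff_sdiff_eq_self (hsub x hx), h, Finset.sdiff_sdiff_eq_self (hsub y hy)]))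
    (fun x _ => mem_insert_self _ _) (fun x _ => by simp) (hM.trans_eq hEt.symm)
  have hc : (insert f (E.erase x)).card = t := by
    rw [card_insert_of_notMem (fun h => hf.2 (mem_of_mem_erase h)), card_erase_of_mem hx]
    omega
  have hc' : (G \ insert f (E.erase x)).card = t := by
    rw [card_sdiff_of_subset (hsub x hx), hc]; omega
  simp only [mem_filter, mem_powersetCard, hsub x hx, hc, hc', sdiff_subset, true_and,
    not_not] at h1 h2
  exact ⟨_, hsub x hx, hc, h1, h2⟩

/-- In a layered family which cuts through the middle layer and has the most intersecting
subfamilies, two complementary sets are not both missing from the middle layer. -/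
lemma compl_mem_of_isLayered {G : Finset ℕ} {t s : ℕ} {A : Finset (Finset ℕ)} (ht : 2 ≤ t)
    (hG : G.card = 2 * t) (hA : IsLayered G t A) (hs : 2 ≤ s) (hne : (interFams s A).Nonempty)
    (hmax : ∀ B : Finset (Finset ℕ), (∀ X ∈ B, X ⊆ G) → B.card = A.card →
      (interFams s B).card ≤ (interFams s A).card)
    (hM : ((G.powersetCard t).filter (· ∉ A)).card < t) {E : Finset ℕ} (hE : E ⊆ G)
    (hEt : E.card = t) (hEA : E ∉ A) : G \ E ∈ A := by
  classical
  by_contra hcA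
  obtain ⟨Y, hY, hYt, hYA, hcYA⟩ := exists_mem_compl_mem ht hG hM hE hEt
  have hcE : (G \ E).card = t := by rw [card_sdiff_of_subset hE, hG]; omega
  have hcY : (G \ Y).card = t := by rw [card_sdiff_of_subset hY, hG]; omega
  have hne' : G \ Y ≠ Y := by
    intro h
    have : Disjoint Y Y := by
      nth_rewrite 1 [← h]
      exact sdiff_disjoint
    rw [disjoint_self_iff_empty] at this
    rw [this, card_empty] at hYt
    omega
  have hneY : ∀ X ∈ A, X ≠ G \ E := fun X hX h => hcA (h ▸ hX)
  set B := insert (G \ E) (A.erase Y) with hB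
  have hBA : B.card = A.card := by
    rw [hB, card_insert_of_notMem (fun h => hcA (mem_of_mem_erase h)), card_erase_add_one hYA]
  have hBl : IsLayered G t B := by
    refine ⟨?_, ?_, ?_⟩
    · intro X hX
      rcases mem_insert.1 hX with rfl | h
      · exact sdiff_subset
      · exact hA.sub X (mem_of_mem_erase h)
    · intro X hX
      rcases mem_insert.1 hX with rfl | h
      · exact hcE.ge
      · exact hA.low X (mem_of_mem_erase h)
    · intro X hX hXt
      refine mem_insert_of_mem (mem_erase.2 ⟨?_, hA.up X hX hXt⟩)
      rintro rfl
      omega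
  have hcap : ∀ X ∈ A, ¬ Disjoint (G \ E) X := by
    intro X hX hd
    obtain ⟨-, -, h⟩ := disjoint_sdiff_of_card hG sdiff_subset (hA.sub X hX) hd hcE.ge
      (hA.low X hX)
    rw [Finset.sdiff_sdiff_eq_self hE] at h
    exact hEA (h ▸ hX)
  have hself : ¬ Disjoint (G \ E) (G \ E) := by
    rw [disjoint_self_iff_empty]
    intro h
    rw [h, card_empty] at hcE
    omega
  let φ : Finset (Finset ℕ) → Finset (Finset ℕ) := fun I =>
    if Y ∈ I then insert (G \ E) (I.erase Y) else I
  have hφ : ∀ I ∈ interFams s A, φ I ∈ interFams s B := by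
    intro I hI
    obtain ⟨hIA, hIs, hmeet⟩ := mem_interFams.1 hI
    simp only [φ]
    split_ifs with h
    · refine mem_interFams.2 ⟨insert_subset_insert _ (erase_subset_erase _ hIA), ?_, ?_⟩
      · rw [card_insert_of_notMem (fun h => hcA (hIA (mem_of_mem_erase h))),
          card_erase_add_one h, hIs]
      · intro X hX Z hZ
        rcases mem_insert.1 hX with rfl | hX <;> rcases mem_insert.1 hZ with rfl | hZ
        · exact hself
        · exact hcap Z (hIA (mem_of_mem_erase hZ))
        · exact fun hd => hcap X (hIA (mem_of_mem_erase hX)) hd.symm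
        · exact hmeet X (mem_of_mem_erase hX) Z (mem_of_mem_erase hZ)
    · refine mem_interFams.2 ⟨fun X hX => mem_insert_of_mem (mem_erase.2 ⟨?_, hIA hX⟩), hIs, hmeet⟩
      rintro rfl
      exact h hX
  have hφinj : ∀ I ∈ interFams s A, ∀ J ∈ interFams s A, φ I = φ J → I = J := by
    have hback : ∀ I ∈ interFams s A, ∀ X, X ∈ I ↔
        (X ≠ Y ∧ X ≠ G \ E ∧ X ∈ φ I) ∨ (X = Y ∧ G \ E ∈ φ I) := by
      intro I hI X
      obtain ⟨hIA, -, -⟩ := mem_interFams.1 hI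
      have h1 : G \ E ∉ I := fun h => hcA (hIA h)
      have h2 : X ∈ I → X ≠ G \ E := fun h => hneY X (hIA h)
      simp only [φ]
      split_ifs with h
      · simp only [mem_insert, mem_erase]
        by_cases hX : X = Y
        · subst hX; simp [h]
        · tauto
      · by_cases hX : X = Y
        · subst hX; simp [h, h1]
        · tauto
    intro I hI J hJ h
    ext X
    rw [hback I hI, hback J hJ, h]
  obtain ⟨J, hJ, hJ1, hJ2⟩ := exists_mem_interFams_pair hG le_rfl hBl hs
    (hne.elim fun I hI => ⟨φ I, hφ I hI⟩) (D := G \ E) (W := G \ Y) (mem_insert_self _ _)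
    (mem_insert_of_mem (mem_erase.2 ⟨hne', hcYA⟩)) (hcap _ hcYA) hcY.ge
  obtain ⟨I, hI, rfl⟩ := surj_on_of_inj_on_of_card_le (fun I _ => φ I) hφ
    (fun I J hI hJ h => hφinj I hI J hJ h) (hmax B hBl.sub hBA) J hJ
  obtain ⟨hIA, -, hmeet⟩ := mem_interFams.1 hI
  simp only [φ] at hJ1 hJ2
  split_ifs at hJ1 hJ2 with h
  · rcases mem_insert.1 hJ2 with h' | h'
    · exact hcA (h' ▸ hcYA)
    · exact hmeet _ h _ (mem_of_mem_erase h') disjoint_sdiff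
  · exact hcA (hIA hJ1)

lemma not_isLayered_compress {G : Finset ℕ} {t r s v : ℕ} {A : Finset (Finset ℕ)}
    {τ : Finset ℕ → Finset ℕ} {E : Finset ℕ} (ht : 2 ≤ t)
    (hG : G.card = 2 * t) (hr : r ≤ t) (hs : 2 ≤ s) (hA : ∀ X ∈ A, X ⊆ G)
    (hne : (interFams s A).Nonempty)
    (hmax : ∀ B : Finset (Finset ℕ), (∀ X ∈ B, X ⊆ G) → B.card = A.card →
      (interFams s B).card ≤ (interFams s A).card)
    (hτ : IsLift G v τ) (hvG : v ∈ G) (hE : E ∈ A) (hv : v ∉ E) (hE' : τ E ∉ A)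
    (hM : r = t → ((G.powersetCard t).filter (· ∉ compress A v τ)).card < t) :
    ¬ IsLayered G r (compress A v τ) := by
  intro hL
  set C := compress A v τ with hC
  have hle : (interFams s C).card ≤ (interFams s A).card :=
    hmax C (compress_sub hτ hA) (card_compress hτ)
  have hneC : (interFams s C).Nonempty := hne.elim fun I hI => ⟨_, liftSub_mem hτ hI⟩
  have hmaxC : ∀ B : Finset (Finset ℕ), (∀ X ∈ B, X ⊆ G) → B.card = C.card →
      (interFams s B).card ≤ (interFams s C).card := fun B hB hBC =>
    (hmax B hB (hBC.trans (card_compress hτ))).trans (card_interFams_le_compress hτ)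
  have star : ∀ E W, E ∈ A → v ∉ E → τ E ∉ A → W ∈ C → t ≤ W.card → ¬ Disjoint (τ E) W →
      Disjoint W E → v ∈ W ∧ τ W ∈ A ∧ ¬ Disjoint (τ W) E := by
    intro E W hE hv hE' hW hWt hd hd'
    have hD : τ E ∈ C := (mem_compress hτ).2
      (Or.inl ⟨(hτ.mem_iff E).2 hv, Or.inr (by rwa [hτ.invol])⟩)
    obtain ⟨J, hJ, hJ1, hJ2⟩ := exists_mem_interFams_pair hG hr hL hs hneC hD hW hd hWt
    exact lift_mem_of_card_compress_le hτ hle hE' hJ hJ1 hJ2 hd'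
  have size : ∀ E ∈ A, v ∉ E → τ E ∉ A → E.card ≤ r ∧ r ≤ E.card + 1 := by
    intro E hE hv hE'
    have h1 : E ∉ C := fun h => by rw [mem_compress hτ] at h; tauto
    have h2 : τ E ∈ C := (mem_compress hτ).2
      (Or.inl ⟨(hτ.mem_iff E).2 hv, Or.inr (by rwa [hτ.invol])⟩)
    exact ⟨not_lt.1 fun h => h1 (hL.up E (hA E hE) h), hτ.card_eq E hv ▸ hL.low _ h2⟩
  have step : ∀ E ∈ A, v ∉ E → τ E ∉ A → G \ τ E ∈ A ∧ ¬ E ⊆ τ E := by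
    intro E hE hv hE'
    have hEG := hA E hE
    have hc : (G \ E).card = 2 * t - E.card := by rw [card_sdiff_of_subset hEG, hG]
    obtain ⟨h1, h2⟩ := size E hE hv hE'
    have hEC : E ∉ C := fun h => by rw [mem_compress hτ] at h; tauto
    have hW : G \ E ∈ C := by
      by_cases h : r < (G \ E).card
      · exact hL.up _ sdiff_subset h
      · obtain rfl : r = t := by omega
        exact compl_mem_of_isLayered ht hG hL hs hneC hmaxC (hM rfl) hEG (by omega) hEC
    obtain ⟨-, h3, h4⟩ := star E (G \ E) hE hv hE' hW (by omega)
      (Finset.not_disjoint_iff.2 ⟨v, (hτ.mem_iff E).2 hv, mem_sdiff.2 ⟨hvG, hv⟩⟩) sdiff_disjoint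
    rw [hτ.compl E hEG] at h3 h4
    exact ⟨h3, fun h => h4 (sdiff_disjoint.mono_right h)⟩
  have erase_notMem : ∀ E ∈ A, v ∉ E → τ E ∉ A → t ≤ ((G \ E).erase v).card →
      (G \ E).erase v ∉ C := by
    intro E hE hv hE' hWt hW
    refine absurd (star E _ hE hv hE' hW hWt ?_ (sdiff_disjoint.mono_left (erase_subset _ _))).1
      (notMem_erase v _)
    intro hd
    have hsub : (τ E).erase v ⊆ E := by
      intro x hx
      rw [mem_erase] at hx
      by_contra hxE
      exact Finset.disjoint_left.1 hd hx.2
        (mem_erase.2 ⟨hx.1, mem_sdiff.2 ⟨hτ.sub E (hA E hE) hx.2, hxE⟩⟩)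
    have := eq_of_subset_of_card_le hsub (by
      rw [card_erase_of_mem ((hτ.mem_iff E).2 hv), hτ.card_eq E hv]; omega)
    exact (step E hE hv hE').2 (this.symm.subset.trans (erase_subset _ _))
  have ecard : ∀ E ∈ A, v ∉ E → ((G \ E).erase v).card = 2 * t - E.card - 1 := by
    intro E hE hv
    rw [card_erase_of_mem (mem_sdiff.2 ⟨hvG, hv⟩), card_sdiff_of_subset (hA E hE), hG]
  obtain ⟨h1, h2⟩ := size E hE hv hE'
  rcases hr.lt_or_eq with hrt | rfl
  · have hc := ecard E hE hv
    exact erase_notMem E hE hv hE' (by omega)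
      (hL.up _ ((erase_subset _ _).trans sdiff_subset) (by omega))
  specialize hM rfl
  have moved : ∀ X ∈ A, X.card + 1 = r → v ∉ X ∧ τ X ∉ A := by
    intro X hX hXr
    have h : X ∉ C := fun h => by have := hL.low X h; omega
    rw [mem_compress hτ] at h
    tauto
  have small : ∀ E ∈ A, E.card + 1 = r → False := by
    intro E hE hEr
    obtain ⟨hv, hE'⟩ := moved E hE hEr
    have hEG := hA E hE
    have hScard : ((G \ E).erase v).card = r := by rw [ecard E hE hv]; omega
    have hS : ∀ x ∈ (G \ E).erase v, x ≠ v ∧ x ∈ G ∧ x ∉ E := by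
      intro x hx
      simpa only [mem_erase, mem_sdiff] using hx
    have hins : ∀ x ∈ (G \ E).erase v, insert x E ⊆ G := fun x hx =>
      insert_subset (hS x hx).2.1 hEG
    have hvins : ∀ x ∈ (G \ E).erase v, v ∉ insert x E := fun x hx => by
      rw [mem_insert, not_or]
      exact ⟨(hS x hx).1.symm, hv⟩
    have hinj : Set.InjOn (fun x => insert x E) ((G \ E).erase v : Set ℕ) := by
      intro x hx y hy h
      have : x ∈ insert y E := by
        dsimp only at h
        rw [← h]
        exact mem_insert_self _ _
      exact (mem_insert.1 this).resolve_right (hS x hx).2.2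
    obtain ⟨x, hx, hP, hQ⟩ := exists_notMem_and_notMem (S := (G \ E).erase v) (f := v)
      (P := fun x => G \ insert x E) (Q := fun x => (τ (insert x E)).erase v)
      (fun x hx y hy h => hinj hx hy (by
        dsimp only at h ⊢
        rw [← Finset.sdiff_sdiff_eq_self (hins x hx), h, Finset.sdiff_sdiff_eq_self (hins y hy)]))
      (fun x hx y hy h => hinj hx hy (hτ.injective (by
        dsimp only at h ⊢
        rw [← insert_erase ((hτ.mem_iff _).2 (hvins x hx)), h,
          insert_erase ((hτ.mem_iff _).2 (hvins y hy))])))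
      (fun x hx => mem_sdiff.2 ⟨hvG, hvins x hx⟩) (fun x _ => notMem_erase v _)
      (hM.trans_eq hScard.symm)
    have hc0 : (insert x E).card = r := by rw [card_insert_of_notMem (hS x hx).2.2, hEr]
    have hc1 : (G \ insert x E).card = r := by
      rw [card_sdiff_of_subset (hins x hx), hc0, hG]; omega
    have hc2 : ((τ (insert x E)).erase v).card = r := by
      rw [card_erase_of_mem ((hτ.mem_iff _).2 (hvins x hx)), hτ.card_eq _ (hvins x hx), hc0]
      omega
    have hsub2 : (τ (insert x E)).erase v ⊆ G :=
      (erase_subset _ _).trans (hτ.sub _ (hins x hx))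
    simp only [mem_filter, mem_powersetCard, sdiff_subset, hc1, hc2, hsub2, true_and,
      not_not] at hP hQ
    obtain ⟨-, h3, -⟩ := star E _ hE hv hE' hP hc1.ge
      (Finset.not_disjoint_iff.2 ⟨v, (hτ.mem_iff E).2 hv, mem_sdiff.2 ⟨hvG, hvins x hx⟩⟩)
      (sdiff_disjoint.mono_right (subset_insert _ _))
    rw [hτ.compl _ (hins x hx)] at h3
    have hc3 : (G \ τ (insert x E)).card + 1 = r := by
      rw [card_sdiff_of_subset (hτ.sub _ (hins x hx)), hτ.card_eq _ (hvins x hx), hc0, hG]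
      omega
    obtain ⟨h4, h5⟩ := moved _ h3 hc3
    have heq : (G \ (G \ τ (insert x E))).erase v = (τ (insert x E)).erase v := by
      rw [Finset.sdiff_sdiff_eq_self (hτ.sub _ (hins x hx))]
    have := erase_notMem _ h3 h4 h5
    rw [heq] at this
    exact this hc2.ge hQ
  by_cases hEr : E.card + 1 = r
  · exact small E hE hEr
  · refine small _ (step E hE hv hE').1 ?_
    rw [card_sdiff_of_subset (hτ.sub E (hA E hE)), hτ.card_eq E hv, hG]
    omega

lemma card_filter_compl (G : Finset ℕ) (p : Finset ℕ → Prop) [DecidablePred p] :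
    (G.powerset.filter fun X => p (G \ X)).card = (G.powerset.filter p).card := by
  refine card_bij' (fun X _ => G \ X) (fun X _ => G \ X) ?_ ?_ ?_ ?_
  · intro X hX
    rw [mem_filter, mem_powerset] at hX ⊢
    exact ⟨sdiff_subset, hX.2⟩
  · intro X hX
    rw [mem_filter, mem_powerset] at hX ⊢
    rw [Finset.sdiff_sdiff_eq_self hX.1]
    exact ⟨sdiff_subset, hX.2⟩
  · intro X hX
    exact Finset.sdiff_sdiff_eq_self (mem_powerset.1 (mem_filter.1 hX).1)
  · intro X hX
    exact Finset.sdiff_sdiff_eq_self (mem_powerset.1 (mem_filter.1 hX).1)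

lemma card_groundSet (n : ℕ) : (groundSet n).card = n := by simp [groundSet]

lemma card_allFams (n : ℕ) : (allFams n).card = 2 ^ n := by
  rw [allFams, card_powerset, card_groundSet]

lemma mem_allFams {n : ℕ} {X : Finset ℕ} : X ∈ allFams n ↔ X ⊆ groundSet n := mem_powerset

lemma mem_layerGE {n r : ℕ} {X : Finset ℕ} :
    X ∈ layerGE n r ↔ X ⊆ groundSet n ∧ r ≤ X.card := by
  rw [layerGE, mem_filter, mem_allFams]

lemma card_layerGE (n r : ℕ) : (layerGE n r).card = ∑ k ∈ Icc r n, n.choose k := by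
  rw [card_eq_sum_card_fiberwise (f := card) (t := Icc r n)]
  · refine sum_congr rfl fun k hk => ?_
    rw [mem_Icc] at hk
    rw [← card_groundSet n, ← card_powersetCard, card_groundSet]
    congr 1
    ext X
    rw [mem_filter, mem_layerGE, mem_powersetCard]
    constructor
    · exact fun h => ⟨h.1.1, h.2⟩
    · exact fun h => ⟨⟨h.1, h.2.symm ▸ hk.1⟩, h.2⟩
  · intro X hX
    obtain ⟨h1, h2⟩ := mem_layerGE.1 (mem_coe.1 hX)
    exact mem_coe.2 (mem_Icc.2 ⟨h2, card_groundSet n ▸ card_le_card h1⟩)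

lemma card_layerGE_middle_add {t : ℕ} :
    (layerGE (2 * t) t).card + (layerGE (2 * t) (t + 1)).card = 2 ^ (2 * t) := by
  have h1 : (layerGE (2 * t) t).card =
      ((allFams (2 * t)).filter fun X => ¬ (t + 1 ≤ X.card)).card := by
    rw [layerGE, allFams, ← card_filter_compl]
    congr 1
    refine filter_congr fun X hX => ?_
    have h2 := mem_powerset.1 hX
    have h3 := card_le_card h2
    rw [card_groundSet] at h3
    rw [card_sdiff_of_subset h2, card_groundSet]
    omega
  rw [h1, ← card_allFams, layerGE, add_comm]
  exact card_filter_add_card_filter_not _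

lemma card_filter_mem_allFams {n i : ℕ} (hi : i ∈ groundSet n) :
    2 * ((allFams n).filter fun X => i ∈ X).card = 2 ^ n := by
  have h1 : ((allFams n).filter fun X => ¬ (i ∈ X)).card =
      ((allFams n).filter fun X => i ∈ X).card := by
    rw [allFams, ← card_filter_compl _ fun X => i ∈ X]
    congr 1
    refine filter_congr fun X _ => ?_
    rw [mem_sdiff]
    tauto
  have h2 := card_filter_add_card_filter_not (s := allFams n) (fun X => i ∈ X)
  rw [h1, card_allFams] at h2
  omega

/-- If all subsets of `G` with exactly one element more than some set of `A` belong to `A`, then so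
do all subsets of `G` larger than some set of `A`. -/
lemma mem_of_card_lt {G : Finset ℕ} {A : Finset (Finset ℕ)}
    (h : ∀ E ∈ A, ∀ D ⊆ G, D.card = E.card + 1 → D ∈ A) {E : Finset ℕ} (hE : E ∈ A) :
    ∀ D ⊆ G, E.card < D.card → D ∈ A := by
  suffices ∀ k, ∀ D ⊆ G, D.card = E.card + k + 1 → D ∈ A from fun D hD hc =>
    this (D.card - E.card - 1) D hD (by omega)
  intro k
  induction k with
  | zero => exact fun D hD hc => h E hE D hD hc
  | succ k ih =>
    intro D hD hc
    obtain ⟨x, hx⟩ : D.Nonempty := card_pos.1 (by omega)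
    have hc' : (D.erase x).card = E.card + k + 1 := by rw [card_erase_of_mem hx]; omega
    exact h _ (ih _ ((erase_subset x D).trans hD) hc') D hD (by omega)

lemma isLayered_of_succ_mem {n r : ℕ} {A : Finset (Finset ℕ)} (hA : A ⊆ allFams n)
    (h : ∀ E ∈ A, ∀ D ⊆ groundSet n, D.card = E.card + 1 → D ∈ A)
    (h1 : (layerGE n (r + 1)).card ≤ A.card) (h2 : A.card < (layerGE n r).card) :
    IsLayered (groundSet n) r A := by
  refine ⟨fun X hX => mem_allFams.1 (hA hX), fun X hX => ?_, fun X hX hr => ?_⟩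
  · by_contra hc
    refine h2.not_ge (card_le_card fun Y hY => ?_)
    obtain ⟨h3, h4⟩ := mem_layerGE.1 hY
    exact mem_of_card_lt h hX Y h3 (by omega)
  · by_contra hc
    refine h1.not_gt (card_lt_card ?_)
    refine (ssubset_iff_of_subset fun Y hY => ?_).2 ⟨X, mem_layerGE.2 ⟨hX, hr⟩, hc⟩
    refine mem_layerGE.2 ⟨mem_allFams.1 (hA hY), ?_⟩
    by_contra hY'
    exact hc (mem_of_card_lt h hY X hX (by omega))

lemma interFams_nonempty_of_isMax {n s : ℕ} {A : Finset (Finset ℕ)} (hn : 1 ≤ n)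
    (hs : s ≤ 2 ^ (n - 1)) (hN : 2 ^ (n - 1) ≤ A.card) (hA : A ⊆ allFams n)
    (hmax : ∀ B ⊆ allFams n, B.card = A.card → (interFams s B).card ≤ (interFams s A).card) :
    (interFams s A).Nonempty := by
  have hcard := card_filter_mem_allFams (n := n) (i := 1) (by simp [groundSet, hn])
  have hpow : 2 ^ n = 2 * 2 ^ (n - 1) := by rw [← pow_succ']; congr 1; omega
  obtain ⟨B, hB1, hB2, hB3⟩ := exists_subsuperset_card_eq (n := A.card)
    (filter_subset (fun X : Finset ℕ => 1 ∈ X) (allFams n)) (by omega) (card_le_card hA)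
  obtain ⟨I, hI1, hI2⟩ := exists_subset_card_eq (n := s)
    (s := (allFams n).filter fun X => 1 ∈ X) (by omega)
  have hI : I ∈ interFams s B := mem_interFams.2 ⟨hI1.trans hB1, hI2, fun X hX Y hY =>
    Finset.not_disjoint_iff.2 ⟨1, (mem_filter.1 (hI1 hX)).2, (mem_filter.1 (hI1 hY)).2⟩⟩
  exact card_pos.1 ((card_pos.2 ⟨I, hI⟩).trans_le (hmax B hB2 hB3))

theorem stmt4 (n t s N r : ℕ) (ht : 2 ≤ t) (hnt : n = 2 * t)
    (hs1 : 2 ≤ s) (hs2 : s ≤ 2 ^ (n - 1))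
    (hN1 : 2 ^ (n - 1) + n.choose t / 2 - t < N) (hN2 : N ≤ 2 ^ n)
    (hr1 : ∑ k ∈ Finset.Icc (r + 1) n, n.choose k ≤ N)
    (hr2 : N < ∑ k ∈ Finset.Icc r n, n.choose k)
    (𝓐 : Finset (Finset ℕ)) (h𝓐 : 𝓐 ⊆ allFams n) (hcard : 𝓐.card = N)
    (hmax : ∀ 𝓐' ⊆ allFams n, 𝓐'.card = N →
        (interFams s 𝓐').card ≤ (interFams s 𝓐).card) :
    layerGE n (r + 1) ⊆ 𝓐 ∧ ∀ A ∈ 𝓐, r ≤ A.card := by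
  classical
  have hpow : 2 ^ n = 2 * 2 ^ (n - 1) := by rw [← pow_succ']; congr 1; omega
  have hmid : (layerGE n t).card + (layerGE n (t + 1)).card = 2 ^ n := by
    rw [hnt]; exact card_layerGE_middle_add
  have hdiff : (layerGE n t).card = (layerGE n (t + 1)).card + n.choose t := by
    rw [card_layerGE, card_layerGE, ← add_sum_Ioc_eq_sum_Icc (by omega : t ≤ n), add_comm]
    congr 2
    ext k
    simp only [mem_Ioc, mem_Icc, Nat.succ_le_iff]
  have hchoose : 2 * t ≤ n.choose t := by
    have := Nat.choose_le_centralBinom 1 t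
    rw [Nat.choose_one_right, Nat.centralBinom, ← hnt] at this
    omega
  have hNpow : 2 ^ (n - 1) ≤ N := by omega
  have hNt : (layerGE n t).card < N + t := by omega
  have hrt : r ≤ t := by
    by_contra! hc
    have : (layerGE n r).card ≤ (layerGE n (t + 1)).card := card_le_card fun X hX => by
      rw [mem_layerGE] at hX ⊢
      exact ⟨hX.1, Nat.le_trans hc hX.2⟩
    rw [card_layerGE n r] at this
    omega
  rw [← card_layerGE] at hr1 hr2
  suffices hsucc : ∀ E ∈ 𝓐, ∀ D ⊆ groundSet n, D.card = E.card + 1 → D ∈ 𝓐 by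
    have hL := isLayered_of_succ_mem h𝓐 hsucc (hcard ▸ hr1) (hcard ▸ hr2)
    exact ⟨fun X hX => hL.up X (mem_layerGE.1 hX).1 (mem_layerGE.1 hX).2, hL.low⟩
  by_contra hns
  let bad := (allFams n).powerset.filter fun A => A.card = N ∧
    (∀ B ⊆ allFams n, B.card = N → (interFams s B).card ≤ (interFams s A).card) ∧
    ¬ ∀ E ∈ A, ∀ D ⊆ groundSet n, D.card = E.card + 1 → D ∈ A
  obtain ⟨A, hAbad, hAmax⟩ := exists_max_image bad (fun A => ∑ X ∈ A, X.card)
    ⟨𝓐, mem_filter.2 ⟨mem_powerset.2 h𝓐, hcard, hmax, hns⟩⟩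
  obtain ⟨hA, hAN, hAopt, hAns⟩ := mem_filter.1 hAbad
  rw [mem_powerset] at hA
  push Not at hAns
  obtain ⟨E, hE, D, hD, hDE, hDA⟩ := hAns
  obtain ⟨v, hvD, hvE⟩ := exists_mem_notMem_of_card_lt_card (s := E) (t := D) (by omega)
  obtain ⟨τ, hτ, rfl⟩ := exists_isLift (mem_allFams.1 (hA hE)) hD hvD hvE hDE
  have hAG : ∀ X ∈ A, X ⊆ groundSet n := fun X hX => mem_allFams.1 (hA hX)
  have hC : compress A v τ ⊆ allFams n := fun X hX => mem_allFams.2 (compress_sub hτ hAG X hX)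
  have hCN : (compress A v τ).card = N := (card_compress hτ).trans hAN
  have hCsucc : ∀ E ∈ compress A v τ, ∀ D ⊆ groundSet n, D.card = E.card + 1 →
      D ∈ compress A v τ := by
    by_contra hc
    exact (hAmax _ (mem_filter.2 ⟨mem_powerset.2 hC, hCN, fun B hB hBN =>
      (hAopt B hB hBN).trans (card_interFams_le_compress hτ), hc⟩)).not_gt
      (sum_card_lt_sum_card_compress hτ hE hvE hDA)
  have hL : IsLayered (groundSet n) r (compress A v τ) :=
    isLayered_of_succ_mem hC hCsucc (hCN ▸ hr1) (hCN ▸ hr2)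
  refine not_isLayered_compress ht ((card_groundSet n).trans hnt) hrt hs1 hAG
    (interFams_nonempty_of_isMax (by omega) hs2 (hAN ▸ hNpow) hA (hAN ▸ hAopt))
    (fun B hB hBA => hAopt B (fun X hX => mem_allFams.2 (hB X hX)) (hBA.trans hAN))
    hτ (hD hvD) hE hvE hDA ?_ hL
  rintro rfl
  have hsub : compress A v τ ⊆ layerGE n r := fun X hX =>
    mem_layerGE.2 ⟨hL.sub X hX, hL.low X hX⟩
  have hle : ((groundSet n).powersetCard r).filter (· ∉ compress A v τ) ⊆
      layerGE n r \ compress A v τ := by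
    intro X hX
    rw [mem_filter, mem_powersetCard] at hX
    exact mem_sdiff.2 ⟨mem_layerGE.2 ⟨hX.1.1, hX.1.2.ge⟩, hX.2⟩
  have := card_le_card hle
  rw [card_sdiff_of_subset hsub, hCN] at this
  omega
end

section
/- Let n ≥ 1, let s be an integer with 2 ≤ s ≤ 2^(n−1), and let ℓ be an integer with 1 ≤ ℓ < n/2 − 1. Suppose 𝓐 is a family of subsets of [n] satisfying [n]^(>ℓ+1) ⊆ 𝓐, [n−ℓ, n] ∉ 𝓐 and [ℓ] ∈ 𝓐. Then there exists a (U,v,f)-compression C such that |𝕀^(s)(C(𝓐))| > |𝕀^(s)(𝓐)|. -/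
open Finset

/-- The `(U,v,f)`-compression of a single set `A` (with `v ∉ A`):
`C(A) = (A \ U) ∪ {v} ∪ f(A ∩ U)`. -/
def cSet (U : Finset ℕ) (v : ℕ) (f : ℕ → ℕ) (A : Finset ℕ) : Finset ℕ :=
  (A \ U) ∪ {v} ∪ (A ∩ U).image f

/-- The `(U,v,f)`-compression of a family: each `A ∈ 𝓐` with `v ∉ A` is replaced by
`cSet U v f A` provided this set is not already in `𝓐`. -/
def cFam (U : Finset ℕ) (v : ℕ) (f : ℕ → ℕ) (𝓐 : Finset (Finset ℕ)) :
    Finset (Finset ℕ) :=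
  𝓐.image fun A => if v ∉ A ∧ cSet U v f A ∉ 𝓐 then cSet U v f A else A

/-- The data of a valid `(U,v,f)`-compression on `[n]`. -/
def IsUVF (n : ℕ) (U : Finset ℕ) (v : ℕ) (f : ℕ → ℕ) : Prop :=
  U ⊆ Finset.Icc 1 n ∧ Even U.card ∧ v ∈ Finset.Icc 1 n ∧ v ∉ U ∧
    (∀ x ∈ U, f x ∈ U) ∧ (∀ x ∈ U, f (f x) = x) ∧ ∀ x ∈ U, f x ≠ x

section Compression

variable {α : Type*} {C : Finset α → Finset α} {v : α}

/-- The members of `𝓔` that are reachable from a member moved by the compression of `𝓐`, where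
`A` is joined to `B` when `C A` and `B` are disjoint. -/
inductive MoveReachable (C : Finset α → Finset α) (v : α) (𝓐 𝓔 : Finset (Finset α)) :
    Finset α → Prop
  | moved {A} : A ∈ 𝓔 → v ∉ A → C A ∉ 𝓐 → MoveReachable C v 𝓐 𝓔 A
  | step {A B} : MoveReachable C v 𝓐 𝓔 A → B ∈ 𝓔 → v ∉ B → Disjoint (C A) B →
      MoveReachable C v 𝓐 𝓔 B

variable {𝓐 𝓔 𝓔' : Finset (Finset α)} {A B : Finset α}

theorem MoveReachable.mem (h : MoveReachable C v 𝓐 𝓔 A) : A ∈ 𝓔 := by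
  cases h <;> assumption

theorem MoveReachable.notMem (h : MoveReachable C v 𝓐 𝓔 A) : v ∉ A := by
  cases h <;> assumption

variable [DecidableEq α]

theorem MoveReachable.image_notMem (h : MoveReachable C v 𝓐 𝓔 A)
    (hsymm : ∀ A B, v ∉ A → v ∉ B → Disjoint (C A) B → Disjoint (C B) A)
    (hsub : 𝓔 ⊆ 𝓐) (hE : ∀ B ∈ 𝓔, ∀ B' ∈ 𝓔, (B ∩ B').Nonempty) : C A ∉ 𝓔 := by
  cases h with
  | moved _ _ h => exact fun h' => h (hsub h')
  | step hA hB hv hd =>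
    intro h'
    exact not_disjoint_iff_nonempty_inter.2 (hE _ h' _ hA.mem) (hsymm _ _ hA.notMem hv hd)

open scoped Classical in
/-- Apply `C` to the members of `𝓔` reachable from a moved member. -/
noncomputable def reachCompress (C : Finset α → Finset α) (v : α) (𝓐 𝓔 : Finset (Finset α)) :
    Finset (Finset α) :=
  𝓔.image fun A => if MoveReachable C v 𝓐 𝓔 A then C A else A

theorem mem_reachCompress : B ∈ reachCompress C v 𝓐 𝓔 ↔
    (∃ A, MoveReachable C v 𝓐 𝓔 A ∧ C A = B) ∨ (B ∈ 𝓔 ∧ ¬ MoveReachable C v 𝓐 𝓔 B) := by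
  simp only [reachCompress, mem_image]
  constructor
  · rintro ⟨A, hA, rfl⟩
    split_ifs with h
    · exact Or.inl ⟨A, h, rfl⟩
    · exact Or.inr ⟨hA, h⟩
  · rintro (⟨A, h, rfl⟩ | ⟨hB, h⟩)
    · exact ⟨A, h.mem, if_pos h⟩
    · exact ⟨B, hB, if_neg h⟩

theorem card_reachCompress
    (hinj : ∀ A B, v ∉ A → v ∉ B → C A = C B → A = B)
    (hsymm : ∀ A B, v ∉ A → v ∉ B → Disjoint (C A) B → Disjoint (C B) A)
    (hsub : 𝓔 ⊆ 𝓐) (hE : ∀ B ∈ 𝓔, ∀ B' ∈ 𝓔, (B ∩ B').Nonempty) :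
    (reachCompress C v 𝓐 𝓔).card = 𝓔.card := by
  classical
  apply card_image_of_injOn
  intro A hA B hB h
  dsimp only at h
  split_ifs at h with h1 h2 h2
  · exact hinj _ _ h1.notMem h2.notMem h
  · exact absurd (h ▸ hB) (h1.image_notMem hsymm hsub hE)
  · exact absurd (h ▸ hA) (h2.image_notMem hsymm hsub hE)
  · exact h

theorem reachCompress_inter_nonempty (hv : ∀ A, v ∈ C A)
    (hE : ∀ B ∈ 𝓔, ∀ B' ∈ 𝓔, (B ∩ B').Nonempty) :
    ∀ B ∈ reachCompress C v 𝓐 𝓔, ∀ B' ∈ reachCompress C v 𝓐 𝓔, (B ∩ B').Nonempty := by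
  have mixed : ∀ A B, MoveReachable C v 𝓐 𝓔 A → B ∈ 𝓔 → ¬ MoveReachable C v 𝓐 𝓔 B →
      (C A ∩ B).Nonempty := by
    intro A B hA hB hn
    by_cases hvB : v ∈ B
    · exact ⟨v, mem_inter.2 ⟨hv A, hvB⟩⟩
    · exact not_disjoint_iff_nonempty_inter.1 fun hd => hn (hA.step hB hvB hd)
  intro B hB B' hB'
  rw [mem_reachCompress] at hB hB'
  rcases hB with ⟨A, hA, rfl⟩ | ⟨hB, hn⟩ <;> rcases hB' with ⟨A', hA', rfl⟩ | ⟨hB', hn'⟩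
  · exact ⟨v, mem_inter.2 ⟨hv A, hv A'⟩⟩
  · exact mixed _ _ hA hB' hn'
  · rw [inter_comm]
    exact mixed _ _ hA' hB hn
  · exact hE _ hB _ hB'

theorem MoveReachable.of_reachCompress_eq (h : MoveReachable C v 𝓐 𝓔 A)
    (hinj : ∀ A B, v ∉ A → v ∉ B → C A = C B → A = B)
    (hsymm : ∀ A B, v ∉ A → v ∉ B → Disjoint (C A) B → Disjoint (C B) A)
    (hsub : 𝓔' ⊆ 𝓐) (hE : ∀ B ∈ 𝓔', ∀ B' ∈ 𝓔', (B ∩ B').Nonempty)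
    (heq : reachCompress C v 𝓐 𝓔 = reachCompress C v 𝓐 𝓔') : MoveReachable C v 𝓐 𝓔' A := by
  induction h with
  | @moved A hA hvA hC =>
    have hm : C A ∈ reachCompress C v 𝓐 𝓔' :=
      heq ▸ mem_reachCompress.2 (Or.inl ⟨A, .moved hA hvA hC, rfl⟩)
    rcases mem_reachCompress.1 hm with ⟨A', hA', h⟩ | ⟨h, -⟩
    · rwa [← hinj _ _ hA'.notMem hvA h]
    · exact absurd (hsub h) hC
  | @step A B hA hB hvB hd ih =>
    have hm : C B ∈ reachCompress C v 𝓐 𝓔' :=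
      heq ▸ mem_reachCompress.2 (Or.inl ⟨B, hA.step hB hvB hd, rfl⟩)
    rcases mem_reachCompress.1 hm with ⟨A', hA', h⟩ | ⟨h, -⟩
    · rwa [← hinj _ _ hA'.notMem hvB h]
    · exact absurd (hsymm _ _ hA.notMem hvB hd)
        (not_disjoint_iff_nonempty_inter.2 (hE _ h _ ih.mem))

theorem subset_of_reachCompress_eq
    (hinj : ∀ A B, v ∉ A → v ∉ B → C A = C B → A = B)
    (hsymm : ∀ A B, v ∉ A → v ∉ B → Disjoint (C A) B → Disjoint (C B) A)
    (hsub : 𝓔 ⊆ 𝓐) (hE : ∀ B ∈ 𝓔, ∀ B' ∈ 𝓔, (B ∩ B').Nonempty)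
    (hsub' : 𝓔' ⊆ 𝓐) (hE' : ∀ B ∈ 𝓔', ∀ B' ∈ 𝓔', (B ∩ B').Nonempty)
    (heq : reachCompress C v 𝓐 𝓔 = reachCompress C v 𝓐 𝓔') : 𝓔 ⊆ 𝓔' := by
  intro B hB
  by_cases h : MoveReachable C v 𝓐 𝓔 B
  · exact (h.of_reachCompress_eq hinj hsymm hsub' hE' heq).mem
  · have hm : B ∈ reachCompress C v 𝓐 𝓔' := heq ▸ mem_reachCompress.2 (Or.inr ⟨hB, h⟩)
    rcases mem_reachCompress.1 hm with ⟨A, hA, rfl⟩ | ⟨h, -⟩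
    · exact absurd hB
        ((hA.of_reachCompress_eq hinj hsymm hsub hE heq.symm).image_notMem hsymm hsub hE)
    · exact h

theorem reachCompress_subset (hv : ∀ A, v ∈ C A) (hsub : 𝓔 ⊆ 𝓐) :
    reachCompress C v 𝓐 𝓔 ⊆ 𝓐.image fun A => if v ∉ A ∧ C A ∉ 𝓐 then C A else A := by
  intro B hB
  rw [mem_image]
  rcases mem_reachCompress.1 hB with ⟨A, hA, rfl⟩ | ⟨hB, hn⟩
  · by_cases h : C A ∈ 𝓐
    · exact ⟨C A, h, if_neg fun h' => h'.1 (hv A)⟩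
    · exact ⟨A, hsub hA.mem, if_pos ⟨hA.notMem, h⟩⟩
  · exact ⟨B, hsub hB, if_neg fun h' => hn (.moved hB h'.1 h'.2)⟩

end Compression

section UVF

variable {n : ℕ} {U : Finset ℕ} {v : ℕ} {f : ℕ → ℕ} {A B : Finset ℕ}

theorem mem_cSet {x : ℕ} :
    x ∈ cSet U v f A ↔ x = v ∨ (x ∈ A ∧ x ∉ U) ∨ ∃ y, (y ∈ A ∧ y ∈ U) ∧ f y = x := by
  simp only [cSet, mem_union, mem_sdiff, mem_singleton, mem_image, mem_inter]
  tauto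

theorem IsUVF.disjoint_cSet (h : IsUVF n U v f) (hA : v ∉ A)
    (hd : Disjoint (cSet U v f A) B) : Disjoint (cSet U v f B) A := by
  obtain ⟨-, -, -, -, hU, hff, -⟩ := h
  rw [disjoint_left] at hd ⊢
  intro x hx hxA
  rcases mem_cSet.1 hx with rfl | ⟨hxB, hxU⟩ | ⟨y, ⟨hyB, hyU⟩, rfl⟩
  · exact hA hxA
  · exact hd (mem_cSet.2 (Or.inr (Or.inl ⟨hxA, hxU⟩))) hxB
  · exact hd (mem_cSet.2 (Or.inr (Or.inr ⟨f y, ⟨hxA, hU y hyU⟩, hff y hyU⟩))) hyB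

theorem IsUVF.subset_of_cSet_eq (h : IsUVF n U v f) (hA : v ∉ A)
    (heq : cSet U v f A = cSet U v f B) : A ⊆ B := by
  obtain ⟨-, -, -, hvU, hU, hff, -⟩ := h
  intro x hx
  by_cases hxU : x ∈ U
  · have hm : f x ∈ cSet U v f B := heq ▸ mem_cSet.2 (Or.inr (Or.inr ⟨x, ⟨hx, hxU⟩, rfl⟩))
    rcases mem_cSet.1 hm with h | ⟨-, h⟩ | ⟨y, ⟨hyB, hyU⟩, h⟩
    · exact absurd (h ▸ hU x hxU) hvU
    · exact absurd (hU x hxU) h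
    · rwa [← hff x hxU, ← h, hff y hyU]
  · have hm : x ∈ cSet U v f B := heq ▸ mem_cSet.2 (Or.inr (Or.inl ⟨hx, hxU⟩))
    rcases mem_cSet.1 hm with rfl | ⟨h, -⟩ | ⟨y, ⟨hyB, hyU⟩, rfl⟩
    · exact absurd hx hA
    · exact h
    · exact absurd (hU y hyU) hxU

theorem IsUVF.card_le_card_cSet (h : IsUVF n U v f) : A.card ≤ (cSet U v f A).card := by
  obtain ⟨-, -, -, -, hU, hff, -⟩ := h
  apply card_le_card_of_injOn fun x => if x ∈ U then f x else x
  · intro x hx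
    have hx : x ∈ A := hx
    change (if x ∈ U then f x else x) ∈ cSet U v f A
    split_ifs with hxU
    · exact mem_cSet.2 (Or.inr (Or.inr ⟨x, ⟨hx, hxU⟩, rfl⟩))
    · exact mem_cSet.2 (Or.inr (Or.inl ⟨hx, hxU⟩))
  · intro x _ y _ hxy
    dsimp only at hxy
    split_ifs at hxy with hx hy hy
    · rw [← hff x hx, hxy, hff y hy]
    · exact absurd (hxy ▸ hU x hx) hy
    · exact absurd (hxy ▸ hU y hy) hx
    · exact hxy

theorem IsUVF.cSet_subset (h : IsUVF n U v f) (hA : A ⊆ Icc 1 n) :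
    cSet U v f A ⊆ Icc 1 n := by
  obtain ⟨hUn, -, hvn, -, hU, -, -⟩ := h
  intro x hx
  rcases mem_cSet.1 hx with rfl | ⟨h, -⟩ | ⟨y, ⟨-, hy⟩, rfl⟩
  · exact hvn
  · exact hA h
  · exact hUn (hU y hy)

theorem IsUVF.mem_cFam_of_lt_card (h : IsUVF n U v f) {𝓐 : Finset (Finset ℕ)} {k : ℕ}
    (hsub : ((allFams n).filter fun A => k < A.card) ⊆ 𝓐) (hA : A ⊆ Icc 1 n)
    (hk : k < A.card) : A ∈ cFam U v f 𝓐 := by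
  refine mem_image.2 ⟨A, hsub (mem_filter.2 ⟨mem_powerset.2 hA, hk⟩), if_neg fun h' => h'.2 ?_⟩
  exact hsub (mem_filter.2 ⟨mem_powerset.2 (h.cSet_subset hA), hk.trans_le h.card_le_card_cSet⟩)

/-- A compression strictly increases the number of intersecting subfamilies of size `s` as soon as
some intersecting subfamily of the compressed family contains both the image of a moved set `M` and
a set `E` avoiding `v` and disjoint from `M`. -/
theorem IsUVF.card_interFams_lt (h : IsUVF n U v f) {s : ℕ} {𝓐 𝓕 : Finset (Finset ℕ)}
    {M E : Finset ℕ} (h𝓕 : 𝓕 ∈ interFams s (cFam U v f 𝓐)) (hvM : v ∉ M)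
    (hM : cSet U v f M ∉ 𝓐) (hM𝓕 : cSet U v f M ∈ 𝓕) (hE𝓕 : E ∈ 𝓕) (hvE : v ∉ E)
    (hd : Disjoint E M) :
    (interFams s 𝓐).card < (interFams s (cFam U v f 𝓐)).card := by
  have hv : ∀ A, v ∈ cSet U v f A := fun A => mem_cSet.2 (Or.inl rfl)
  have hinj : ∀ A B, v ∉ A → v ∉ B → cSet U v f A = cSet U v f B → A = B :=
    fun A B hA hB he => (h.subset_of_cSet_eq hA he).antisymm (h.subset_of_cSet_eq hB he.symm)
  have hsymm : ∀ A B, v ∉ A → v ∉ B → Disjoint (cSet U v f A) B → Disjoint (cSet U v f B) A :=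
    fun A B hA _ => h.disjoint_cSet hA
  have hmem : ∀ {𝓔 𝓑 : Finset (Finset ℕ)}, 𝓔 ∈ interFams s 𝓑 ↔
      (𝓔 ⊆ 𝓑 ∧ 𝓔.card = s) ∧ ∀ B ∈ 𝓔, ∀ B' ∈ 𝓔, (B ∩ B').Nonempty := by
    simp [interFams, mem_powersetCard]
  have hcard : (interFams s 𝓐).card =
      ((interFams s 𝓐).image (reachCompress (cSet U v f) v 𝓐)).card := by
    refine (card_image_of_injOn fun 𝓔 h1 𝓔' h2 heq => ?_).symm
    obtain ⟨⟨hs1, -⟩, hi1⟩ := hmem.1 h1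
    obtain ⟨⟨hs2, -⟩, hi2⟩ := hmem.1 h2
    exact (subset_of_reachCompress_eq hinj hsymm hs1 hi1 hs2 hi2 heq).antisymm
      (subset_of_reachCompress_eq hinj hsymm hs2 hi2 hs1 hi1 heq.symm)
  rw [hcard]
  refine card_lt_card (ssubset_iff_of_subset ?_ |>.2 ⟨𝓕, h𝓕, ?_⟩)
  · intro 𝓖 h𝓖
    obtain ⟨𝓔, h𝓔, rfl⟩ := mem_image.1 h𝓖
    obtain ⟨⟨hs, hc⟩, hi⟩ := hmem.1 h𝓔
    exact hmem.2 ⟨⟨reachCompress_subset hv hs,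
      (card_reachCompress hinj hsymm hs hi).trans hc⟩, reachCompress_inter_nonempty hv hi⟩
  · intro h𝓖
    obtain ⟨𝓔, h𝓔, rfl⟩ := mem_image.1 h𝓖
    obtain ⟨⟨hs, -⟩, hi⟩ := hmem.1 h𝓔
    have hM𝓔 : M ∈ 𝓔 := by
      rcases mem_reachCompress.1 hM𝓕 with ⟨A, hA, he⟩ | ⟨h', -⟩
      · rw [← hinj _ _ hA.notMem hvM he]
        exact hA.mem
      · exact absurd (hs h') hM
    rcases mem_reachCompress.1 hE𝓕 with ⟨A, -, rfl⟩ | ⟨hE, -⟩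
    · exact hvE (hv A)
    · exact not_disjoint_iff_nonempty_inter.2 (hi _ hE _ hM𝓔) hd

end UVF

/-- A maximum intersecting family on `[n]` containing `D`: the supersets of `D`, together with the
sets meeting `D` of size more than `n / 2`, or of size `n / 2` and containing `n`. -/
def halfFam (n : ℕ) (D : Finset ℕ) : Finset (Finset ℕ) :=
  (allFams n).filter fun X =>
    D ⊆ X ∨ ((X ∩ D).Nonempty ∧ (n < 2 * X.card ∨ (2 * X.card = n ∧ n ∈ X)))

theorem inter_nonempty_of_mem_halfFam {n : ℕ} {D : Finset ℕ} (hD : D.Nonempty) :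
    ∀ X ∈ halfFam n D, ∀ Y ∈ halfFam n D, (X ∩ Y).Nonempty := by
  intro X hX Y hY
  obtain ⟨hXn, hX⟩ := mem_filter.1 hX
  obtain ⟨hYn, hY⟩ := mem_filter.1 hY
  rcases hX with hX | ⟨hXD, hX⟩ <;> rcases hY with hY | ⟨hYD, hY⟩
  · exact hD.mono (subset_inter hX hY)
  · exact hYD.mono (by rw [inter_comm]; exact inter_subset_inter_right hX)
  · exact hXD.mono (inter_subset_inter_left hY)
  · by_cases hn : n ∈ X ∧ n ∈ Y
    · exact ⟨n, mem_inter.2 hn⟩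
    · have hunion : (X ∪ Y).card ≤ n := by
        simpa [groundSet] using
          card_le_card (union_subset (mem_powerset.1 hXn) (mem_powerset.1 hYn))
      have := card_union_add_card_inter X Y
      rw [← card_pos]
      by_contra! h0
      have h1 : 2 * X.card = n := by omega
      have h2 : 2 * Y.card = n := by omega
      refine hn ⟨?_, ?_⟩
      · rcases hX with hX | hX
        · omega
        · exact hX.2
      · rcases hY with hY | hY
        · omega
        · exact hY.2

theorem le_card_halfFam {n : ℕ} {D : Finset ℕ} (hn : 1 ≤ n) (hD : D ⊆ Icc 1 n) :
    2 ^ (n - 1) ≤ (halfFam n D).card := by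
  have hcov : allFams n ⊆ halfFam n D ∪ (halfFam n D).image (Icc 1 n \ ·) := by
    intro X hX
    have hXn : X ⊆ Icc 1 n := mem_powerset.1 hX
    by_contra hnot
    rw [mem_union, not_or] at hnot
    obtain ⟨h1, h2⟩ := hnot
    have h3 : Icc 1 n \ X ∉ halfFam n D :=
      fun h => h2 (mem_image.2 ⟨_, h, Finset.sdiff_sdiff_eq_self hXn⟩)
    have hc : (Icc 1 n \ X).card + X.card = n := by
      simpa using card_sdiff_add_card_eq_card hXn
    simp only [halfFam, mem_filter, not_and, not_or] at h1 h3
    obtain ⟨ha, hb⟩ := h1 hX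
    obtain ⟨hc1, hd⟩ := h3 (mem_powerset.2 sdiff_subset)
    have hXD : (X ∩ D).Nonempty := by
      obtain ⟨x, hxD, hx⟩ := not_subset.1 hc1
      refine ⟨x, mem_inter.2 ⟨?_, hxD⟩⟩
      by_contra hxX
      exact hx (mem_sdiff.2 ⟨hD hxD, hxX⟩)
    have hXD' : ((Icc 1 n \ X) ∩ D).Nonempty := by
      obtain ⟨x, hxD, hx⟩ := not_subset.1 ha
      exact ⟨x, mem_inter.2 ⟨mem_sdiff.2 ⟨hD hxD, hx⟩, hxD⟩⟩
    obtain ⟨hb1, hb2⟩ := hb hXD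
    obtain ⟨hd1, hd2⟩ := hd hXD'
    have hnX : n ∉ X := hb2 (by omega)
    exact hd2 (by omega) (mem_sdiff.2 ⟨mem_Icc.2 ⟨hn, le_rfl⟩, hnX⟩)
  have h1 := card_le_card hcov
  have h2 := card_union_le (halfFam n D) ((halfFam n D).image (Icc 1 n \ ·))
  have h3 : ((halfFam n D).image (Icc 1 n \ ·)).card ≤ (halfFam n D).card := card_image_le
  have h4 : (allFams n).card = 2 ^ n := by simp [allFams, groundSet]
  have h5 : 2 ^ n = 2 ^ (n - 1) * 2 := by rw [← pow_succ, Nat.sub_add_cancel hn]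
  omega

theorem isUVF_reflect {n ℓ : ℕ} (hℓ : 2 * ℓ < n) :
    IsUVF n (Icc 1 ℓ ∪ Icc (n - ℓ) (n - 1)) n (n - ·) := by
  refine ⟨?_, ?_, ?_, ?_, ?_, ?_, ?_⟩
  · intro x hx
    simp only [mem_union, mem_Icc] at hx ⊢
    omega
  · rw [card_union_of_disjoint]
    · exact ⟨ℓ, by simp only [Nat.card_Icc]; omega⟩
    · rw [disjoint_left]
      intro x hx hx'
      simp only [mem_Icc] at hx hx'
      omega
  all_goals
    simp only [mem_union, mem_Icc]
    intros
    omega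

theorem cSet_reflect_Icc {n ℓ : ℕ} (hℓ : 2 * ℓ < n) :
    cSet (Icc 1 ℓ ∪ Icc (n - ℓ) (n - 1)) n (n - ·) (Icc 1 ℓ) = Icc (n - ℓ) n := by
  ext x
  simp only [mem_cSet, mem_union, mem_Icc]
  constructor
  · rintro (h | h | ⟨y, h, rfl⟩) <;> omega
  · intro h
    by_cases hx : x = n
    · exact Or.inl hx
    · exact Or.inr (Or.inr ⟨n - x, by omega, by omega⟩)

theorem stmt7 (n s ℓ : ℕ) (hn : 1 ≤ n) (hs1 : 2 ≤ s) (hs2 : s ≤ 2 ^ (n - 1))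
    (hℓ1 : 1 ≤ ℓ) (hℓ2 : (ℓ : ℝ) < (n : ℝ) / 2 - 1)
    (𝓐 : Finset (Finset ℕ)) (h𝓐 : 𝓐 ⊆ allFams n)
    (hsub : ((allFams n).filter fun A => ℓ + 1 < A.card) ⊆ 𝓐)
    (hnotin : Finset.Icc (n - ℓ) n ∉ 𝓐) (hin : Finset.Icc 1 ℓ ∈ 𝓐) :
    ∃ (U : Finset ℕ) (v : ℕ) (f : ℕ → ℕ), IsUVF n U v f ∧
      (interFams s 𝓐).card < (interFams s (cFam U v f 𝓐)).card := by
  have hℓ : 2 * ℓ + 2 < n := by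
    have : (2 * ℓ + 2 : ℝ) < n := by linarith
    exact_mod_cast this
  have hlt : 2 * ℓ < n := by omega
  have hC := isUVF_reflect hlt
  have himg := cSet_reflect_Icc hlt
  set U := Icc 1 ℓ ∪ Icc (n - ℓ) (n - 1)
  set D := Icc (n - ℓ) n with hD
  set E := Icc (ℓ + 1) (n - 1) with hE
  have hDn : D ⊆ Icc 1 n := Icc_subset_Icc (by omega) le_rfl
  have hEn : E ⊆ Icc 1 n := Icc_subset_Icc (by omega) (by omega)
  have hnD : n ∈ D := mem_Icc.2 ⟨by omega, le_rfl⟩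
  have hnE : n ∉ E := by rw [hE, mem_Icc]; omega
  have hDcard : D.card = ℓ + 1 := by rw [hD, Nat.card_Icc]; omega
  have hEcard : E.card = n - 1 - ℓ := by rw [hE, Nat.card_Icc]; omega
  have hD𝓗 : D ∈ halfFam n D := mem_filter.2 ⟨mem_powerset.2 hDn, Or.inl Subset.rfl⟩
  have hE𝓗 : E ∈ halfFam n D := by
    refine mem_filter.2 ⟨mem_powerset.2 hEn, Or.inr ⟨⟨n - 1, ?_⟩, Or.inl (by omega)⟩⟩
    rw [mem_inter, hE, hD, mem_Icc, mem_Icc]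
    omega
  have hsub𝓗 : halfFam n D ⊆ cFam U n (n - ·) 𝓐 := by
    intro X hX
    obtain ⟨hXn, hX⟩ := mem_filter.1 hX
    have hXn : X ⊆ Icc 1 n := mem_powerset.1 hXn
    by_cases hXD : X = D
    · refine mem_image.2 ⟨Icc 1 ℓ, hin, ?_⟩
      rw [himg, if_pos ⟨by rw [mem_Icc]; omega, hnotin⟩, hXD]
    · refine hC.mem_cFam_of_lt_card hsub hXn ?_
      rcases hX with hX | ⟨-, hX⟩
      · exact hDcard ▸ card_lt_card (hX.ssubset_of_ne (Ne.symm hXD))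
      · omega
  have hpair : ({D, E} : Finset (Finset ℕ)) ⊆ halfFam n D :=
    insert_subset hD𝓗 (singleton_subset_iff.2 hE𝓗)
  obtain ⟨𝓕, hDE, h𝓕, hcard⟩ := exists_subsuperset_card_eq hpair (card_le_two.trans hs1)
    (hs2.trans (le_card_halfFam hn hDn))
  refine ⟨U, n, (n - ·), hC, hC.card_interFams_lt (𝓕 := 𝓕) (M := Icc 1 ℓ) (E := E) ?_ ?_ ?_ ?_
    (hDE (by simp)) hnE ?_⟩
  · refine mem_filter.2 ⟨mem_powersetCard.2 ⟨h𝓕.trans hsub𝓗, hcard⟩, fun X hX Y hY => ?_⟩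
    exact inter_nonempty_of_mem_halfFam ⟨n, hnD⟩ X (h𝓕 hX) Y (h𝓕 hY)
  · rw [mem_Icc]
    omega
  · rwa [himg]
  · rw [himg]
    exact hDE (by simp)
  · rw [disjoint_left]
    intro x hx hx'
    rw [hE, mem_Icc] at hx
    rw [mem_Icc] at hx'
    omega
end
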